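/- arXiv:1803.06742 — 5 statements merged into one kernel-verified Lean document; each statement's English description precedes it below -/
import Mathlib

section
/- For every x ∈ X and every m ∈ {1,…,M}: s*(x) = d_m if and only if ∑_{k=1}^{m−1} σ(d_k,x) < p/(p+h) ≤ ∑_{k=1}^{m} σ(d_k,x) (the left sum being 0 when m = 1). Equivalently, writing P(d) = ∑_{z∈Z} P(d,z), s*(x) = d_m if and only if x ∑_{k=1}^{m−1} P(d_k) 1 < p/(p+h) ≤ x ∑_{k=1}^{m} P(d_k) 1. -/
open Finset

noncomputable section

open scoped Classical

namespace InvCtrl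

variable {N M : ℕ} {Z : Type*}

/-- Membership in the belief space `X ⊆ ℝ^N`. -/
def memX (N : ℕ) (x : Fin N → ℝ) : Prop :=
  (∀ i, 0 ≤ x i) ∧ ∑ i, x i = 1

variable [Fintype Z]

/-- `σ(d_k, z, x) = x ⬝ P(d_k, z) ⬝ 𝟙`. -/
def sigz (P : Fin M → Z → Matrix (Fin N) (Fin N) ℝ) (k : Fin M) (z : Z) (x : Fin N → ℝ) : ℝ :=
  ∑ i, x i * ∑ j, P k z i j

/-- `σ(d_k, x) = ∑_z σ(d_k, z, x)`. -/
def sig (P : Fin M → Z → Matrix (Fin N) (Fin N) ℝ) (k : Fin M) (x : Fin N → ℝ) : ℝ :=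
  ∑ z, sigz P k z x

/-- Posterior belief `λ(d_k, z, x) = x P(d_k, z) / σ(d_k, z, x)` (componentwise). -/
def lam (P : Fin M → Z → Matrix (Fin N) (Fin N) ℝ) (k : Fin M) (z : Z) (x : Fin N → ℝ) :
    Fin N → ℝ :=
  fun j => (∑ i, x i * P k z i j) / sigz P k z x

/-- Single-period cost `c(y, d) = p·(d − y)⁺ + h·(y − d)⁺`. -/
def cst (p hc y dd : ℝ) : ℝ := p * max (dd - y) 0 + hc * max (y - dd) 0

/-- Expected single-period cost `L(x, y) = ∑_k σ(d_k, x) c(y, d_k)`. -/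
def Lf (P : Fin M → Z → Matrix (Fin N) (Fin N) ℝ) (d : Fin M → ℤ) (p hc : ℝ)
    (x : Fin N → ℝ) (y : ℝ) : ℝ :=
  ∑ k, sig P k x * cst p hc y (d k : ℝ)

/-- `s*(x)`: the smallest element of `{d_1, …, d_M}` at which `m ↦ L(x, d_m)` is minimized. -/
def sStar (P : Fin M → Z → Matrix (Fin N) (Fin N) ℝ) (d : Fin M → ℤ) (p hc : ℝ)
    (x : Fin N → ℝ) : ℤ :=
  sInf {t : ℤ | ∃ m : Fin M, t = d m ∧ ∀ k : Fin M, Lf P d p hc x (d m : ℝ) ≤ Lf P d p hc x (d k : ℝ)}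

/-- First-order stochastic dominance `x ⪯ x'`. -/
def sdom (x x' : Fin N → ℝ) : Prop :=
  ∀ n : Fin N, ∑ i ∈ univ.filter (fun i => n ≤ i), x i ≤ ∑ i ∈ univ.filter (fun i => n ≤ i), x' i

/-- The `i`-th standard unit vector in `ℝ^N`. -/
def eV (N : ℕ) (i : Fin N) : Fin N → ℝ := fun j => if j = i then 1 else 0

/-- Assumption A3. -/
def A3 (P : Fin M → Z → Matrix (Fin N) (Fin N) ℝ) : Prop :=
  ∀ i i' : Fin N, i ≤ i' → ∀ m : Fin M,
    ∑ k ∈ univ.filter (fun k : Fin M => m ≤ k), ∑ j, ∑ z, P k z i j ≤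
      ∑ k ∈ univ.filter (fun k : Fin M => m ≤ k), ∑ j, ∑ z, P k z i' j

/-- `A_m(x) = h ∑_{k=1}^m σ(d_k,x) − p ∑_{k=m+1}^M σ(d_k,x)` (for `m = 0, …, M`). -/
def Am (P : Fin M → Z → Matrix (Fin N) (Fin N) ℝ) (p hc : ℝ) (m : ℕ) (x : Fin N → ℝ) : ℝ :=
  hc * ∑ k ∈ univ.filter (fun k : Fin M => (k : ℕ) < m), sig P k x
    - p * ∑ k ∈ univ.filter (fun k : Fin M => m ≤ (k : ℕ)), sig P k x

/-- `B_m(x) = p ∑_{k=m+1}^M d_k σ(d_k,x) − h ∑_{k=1}^m d_k σ(d_k,x)` (for `m = 0, …, M`). -/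
def Bm (P : Fin M → Z → Matrix (Fin N) (Fin N) ℝ) (d : Fin M → ℤ) (p hc : ℝ) (m : ℕ)
    (x : Fin N → ℝ) : ℝ :=
  p * ∑ k ∈ univ.filter (fun k : Fin M => m ≤ (k : ℕ)), (d k : ℝ) * sig P k x
    - hc * ∑ k ∈ univ.filter (fun k : Fin M => (k : ℕ) < m), (d k : ℝ) * sig P k x

theorem sig_eq_aux {N M : ℕ} {Z : Type*} [Fintype Z]
    (P : Fin M → Z → Matrix (Fin N) (Fin N) ℝ) (x : Fin N → ℝ) (S : Finset (Fin M)) :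
    ∑ i, x i * ∑ j, ∑ k ∈ S, ∑ z, P k z i j = ∑ k ∈ S, sig P k x := by
  unfold sig sigz
  have h1 : ∀ i, x i * ∑ j, ∑ k ∈ S, ∑ z, P k z i j
      = ∑ k ∈ S, ∑ z, x i * ∑ j, P k z i j := by
    intro i
    rw [Finset.sum_comm, Finset.mul_sum]
    refine Finset.sum_congr rfl fun k _ => ?_
    rw [Finset.sum_comm, Finset.mul_sum]
  rw [Finset.sum_congr rfl fun i _ => h1 i, Finset.sum_comm]
  refine Finset.sum_congr rfl fun k _ => ?_
  rw [Finset.sum_comm]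

theorem sig_nonneg_aux {N M : ℕ} {Z : Type*} [Fintype Z]
    (P : Fin M → Z → Matrix (Fin N) (Fin N) ℝ) (hPnn : ∀ k z i j, 0 ≤ P k z i j)
    (x : Fin N → ℝ) (hx : memX N x) (k : Fin M) : 0 ≤ sig P k x := by
  unfold sig sigz
  exact Finset.sum_nonneg fun z _ => Finset.sum_nonneg fun i _ =>
    mul_nonneg (hx.1 i) (Finset.sum_nonneg fun j _ => hPnn k z i j)

theorem sig_sum_aux {N M : ℕ} {Z : Type*} [Fintype Z]
    (P : Fin M → Z → Matrix (Fin N) (Fin N) ℝ)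
    (hPst : ∀ i : Fin N, ∑ k : Fin M, ∑ z : Z, ∑ j : Fin N, P k z i j = 1)
    (x : Fin N → ℝ) (hx : memX N x) : ∑ k, sig P k x = 1 := by
  rw [← sig_eq_aux, ← hx.2]
  refine Finset.sum_congr rfl fun i _ => ?_
  have : ∑ j, ∑ k, ∑ z, P k z i j = 1 := by
    rw [← hPst i, Finset.sum_comm]
    refine Finset.sum_congr rfl fun k _ => ?_
    rw [Finset.sum_comm]
  rw [this, mul_one]

/-- Subgradient inequality for the expected cost. -/
theorem subgrad_aux {N M : ℕ} {Z : Type*} [Fintype Z]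
    (P : Fin M → Z → Matrix (Fin N) (Fin N) ℝ) (d : Fin M → ℤ)
    (p hc : ℝ) (hp : 0 < p) (hhc : 0 < hc) (x : Fin N → ℝ)
    (hnn : ∀ k, 0 ≤ sig P k x) (hs : ∑ k, sig P k x = 1)
    (q : Fin M → Prop) [DecidablePred q] (y y' : ℝ)
    (h1 : ∀ k, q k → (d k : ℝ) ≤ y) (h2 : ∀ k, ¬ q k → y ≤ (d k : ℝ)) :
    (y' - y) * ((p + hc) * ∑ k ∈ univ.filter q, sig P k x - p)
      ≤ Lf P d p hc x y' - Lf P d p hc x y := by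
  have e : (y' - y) * ((p + hc) * ∑ k ∈ univ.filter q, sig P k x - p)
      = ∑ k, sig P k x * ((y' - y) * (if q k then hc else -p)) := by
    have e1 : ∀ k, sig P k x * ((y' - y) * (if q k then hc else -p))
        = (y' - y) * ((p + hc) * (if q k then sig P k x else 0) - p * sig P k x) := by
      intro k; split_ifs <;> ring
    rw [Finset.sum_congr rfl fun k _ => e1 k, ← Finset.mul_sum, Finset.sum_sub_distrib,
      ← Finset.mul_sum, ← Finset.mul_sum, hs, Finset.sum_filter, mul_one]
  rw [e]
  unfold Lf
  rw [← Finset.sum_sub_distrib]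
  refine Finset.sum_le_sum fun k _ => ?_
  rw [← mul_sub]
  refine mul_le_mul_of_nonneg_left ?_ (hnn k)
  unfold cst
  have a1 := mul_le_mul_of_nonneg_left (le_max_left ((d k : ℝ) - y') 0) hp.le
  have a2 := mul_le_mul_of_nonneg_left (le_max_right ((d k : ℝ) - y') 0) hp.le
  have a3 := mul_le_mul_of_nonneg_left (le_max_left (y' - (d k : ℝ)) 0) hhc.le
  have a4 := mul_le_mul_of_nonneg_left (le_max_right (y' - (d k : ℝ)) 0) hhc.le
  split_ifs with hq
  · have := h1 k hq
    rw [max_eq_right (by linarith : (d k : ℝ) - y ≤ 0),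
      max_eq_left (by linarith : 0 ≤ y - (d k : ℝ))]
    linarith
  · have := h2 k hq
    rw [max_eq_left (by linarith : 0 ≤ (d k : ℝ) - y),
      max_eq_right (by linarith : y - (d k : ℝ) ≤ 0)]
    linarith

theorem sStar_of_aux {N M : ℕ} {Z : Type*} [Fintype Z]
    (P : Fin M → Z → Matrix (Fin N) (Fin N) ℝ) (d : Fin M → ℤ) (hd : StrictMono d)
    (p hc : ℝ) (hp : 0 < p) (hhc : 0 < hc) (x : Fin N → ℝ)
    (hnn : ∀ k, 0 ≤ sig P k x) (hs : ∑ k, sig P k x = 1) (m : Fin M)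
    (hG : ∑ k ∈ univ.filter (fun k : Fin M => k < m), sig P k x < p / (p + hc))
    (hF : p / (p + hc) ≤ ∑ k ∈ univ.filter (fun k : Fin M => k ≤ m), sig P k x) :
    sStar P d p hc x = d m := by
  have hph : 0 < p + hc := by linarith
  rw [lt_div_iff₀ hph, mul_comm] at hG
  rw [div_le_iff₀ hph, mul_comm] at hF
  have lo : ∀ k, k < m → Lf P d p hc x (d m) < Lf P d p hc x (d k) := by
    intro k hk
    have h := subgrad_aux P d p hc hp hhc x hnn hs (fun k => k < m) (d m) (d k)
      (fun k hk => by exact_mod_cast hd.monotone (le_of_lt hk))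
      (fun k hk => by exact_mod_cast hd.monotone (not_lt.mp hk))
    have hdk : (d k : ℝ) < d m := by exact_mod_cast hd hk
    have := mul_pos_of_neg_of_neg (sub_neg.mpr hdk) (sub_neg.mpr hG)
    linarith
  have hi : ∀ k, m ≤ k → Lf P d p hc x (d m) ≤ Lf P d p hc x (d k) := by
    intro k hk
    have h := subgrad_aux P d p hc hp hhc x hnn hs (fun k => k ≤ m) (d m) (d k)
      (fun k hk => by exact_mod_cast hd.monotone hk)
      (fun k hk => by exact_mod_cast hd.monotone (le_of_lt (not_le.mp hk)))
    have hdk : (d m : ℝ) ≤ d k := by exact_mod_cast hd.monotone hk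
    have := mul_nonneg (sub_nonneg.mpr hdk) (sub_nonneg.mpr hF)
    linarith
  refine IsLeast.csInf_eq ⟨⟨m, rfl, fun k => ?_⟩, ?_⟩
  · rcases lt_or_ge k m with hk | hk
    · exact (lo k hk).le
    · exact hi k hk
  · rintro t ⟨m', rfl, hm'⟩
    refine hd.monotone ?_
    by_contra hlt
    exact absurd (hm' m) (not_le.mpr (lo m' (not_le.mp hlt)))

theorem exists_aux {M : ℕ} (hM : 1 ≤ M) (w : Fin M → ℝ) (hnn : ∀ k, 0 ≤ w k)
    (hs : ∑ k, w k = 1) (r : ℝ) (h0 : 0 < r) (h1 : r ≤ 1) :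
    ∃ m : Fin M, ∑ k ∈ univ.filter (fun k : Fin M => k < m), w k < r ∧
      r ≤ ∑ k ∈ univ.filter (fun k : Fin M => k ≤ m), w k := by
  have hne : ∃ m : Fin M, r ≤ ∑ k ∈ univ.filter (fun k : Fin M => k ≤ m), w k := by
    refine ⟨⟨M - 1, by omega⟩, ?_⟩
    rw [Finset.filter_true_of_mem (fun k _ => Fin.le_def.mpr (by have := k.2; simp; omega)), hs]
    exact h1
  obtain ⟨m, hm, hmin⟩ := WellFounded.has_min (wellFounded_lt (α := Fin M))
    {m : Fin M | r ≤ ∑ k ∈ univ.filter (fun k : Fin M => k ≤ m), w k} hne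
  refine ⟨m, ?_, hm⟩
  by_contra hcon
  rw [not_lt] at hcon
  have hfn : (univ.filter (fun k : Fin M => k < m)).Nonempty := by
    rw [Finset.nonempty_iff_ne_empty]
    intro he
    rw [he, Finset.sum_empty] at hcon
    linarith
  obtain ⟨j, hj, hjm⟩ := Finset.exists_max_image _ id hfn
  refine hmin j ?_ (Finset.mem_filter.mp hj).2
  refine hcon.trans (Finset.sum_le_sum_of_subset_of_nonneg ?_ fun k _ _ => hnn k)
  intro k hk
  exact Finset.mem_filter.mpr ⟨Finset.mem_univ _, hjm k hk⟩

/-- Lemma 2: newsvendor characterization of the myopic base stock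
level `s*(x)`, and its equivalent form in terms of the matrices `P(d) = ∑_z P(d,z)`. -/
theorem stmt1 {N M : ℕ} {Z : Type*} [Fintype Z] [Nonempty Z]
    (hN : 1 ≤ N) (hM : 1 ≤ M)
    (d : Fin M → ℤ) (hd : StrictMono d)
    (P : Fin M → Z → Matrix (Fin N) (Fin N) ℝ)
    (hPnn : ∀ k z i j, 0 ≤ P k z i j)
    (hPst : ∀ i : Fin N, ∑ k : Fin M, ∑ z : Z, ∑ j : Fin N, P k z i j = 1)
    (p hc : ℝ) (hp : 0 < p) (hhc : 0 < hc)
    (x : Fin N → ℝ) (hx : memX N x) (m : Fin M) :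
    (sStar P d p hc x = d m ↔
      (∑ k ∈ univ.filter (fun k : Fin M => k < m), sig P k x < p / (p + hc) ∧
        p / (p + hc) ≤ ∑ k ∈ univ.filter (fun k : Fin M => k ≤ m), sig P k x)) ∧
    (sStar P d p hc x = d m ↔
      (∑ i, x i * ∑ j, ∑ k ∈ univ.filter (fun k : Fin M => k < m), ∑ z, P k z i j
          < p / (p + hc) ∧
        p / (p + hc) ≤
          ∑ i, x i * ∑ j, ∑ k ∈ univ.filter (fun k : Fin M => k ≤ m), ∑ z, P k z i j)) := by
  rw [sig_eq_aux, sig_eq_aux, and_self]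
  have hnn := sig_nonneg_aux P hPnn x hx
  have hs := sig_sum_aux P hPst x hx
  refine ⟨fun h => ?_, fun h => sStar_of_aux P d hd p hc hp hhc x hnn hs m h.1 h.2⟩
  obtain ⟨m0, hG, hF⟩ := exists_aux hM (fun k => sig P k x) hnn hs (p / (p + hc))
    (by positivity) ((div_le_one (by linarith)).mpr (by linarith))
  have h' := sStar_of_aux P d hd p hc hp hhc x hnn hs m0 hG hF
  have : m = m0 := hd.injective (h.symm.trans h')
  subst this
  exact ⟨hG, hF⟩


end InvCtrl
end
end

section
/- Suppose Assumption A3 holds. Then for all x, x' ∈ X with x ⪯ x', one has s*(x) ≤ s*(x'). -/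
open Finset

noncomputable section

open scoped Classical

namespace InvCtrl

variable {N M : ℕ} {Z : Type*}

variable [Fintype Z]

theorem tail_nonneg_aux : ∀ (n : ℕ) (w f : Fin n → ℝ),
    (∀ m : Fin n, 0 ≤ ∑ i ∈ univ.filter (fun i => m ≤ i), w i) → Monotone f → (∀ i, 0 ≤ f i) →
    0 ≤ ∑ i, w i * f i := by
  intro n
  induction n with
  | zero => intro w f _ _ _; simp
  | succ n ih =>
    intro w f hw hf h0
    have h1 := ih (fun i => w i.succ) (fun i => f i.succ - f 0) (by
      intro m
      have := hw m.succ
      rw [Finset.sum_filter, Fin.sum_univ_succ] at this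
      rw [Finset.sum_filter]
      simpa [Fin.succ_le_succ_iff] using this) (by
      intro a b hab
      have := hf (Fin.succ_le_succ_iff.2 hab)
      simpa using this) (by
      intro i
      have := hf (Fin.zero_le i.succ)
      simpa using this)
    have h2 := hw 0
    have h3 : 0 ≤ (∑ i, w i) * f 0 := mul_nonneg (by simpa using h2) (h0 0)
    rw [Fin.sum_univ_succ] at h3 ⊢
    simp only [mul_sub, Finset.sum_sub_distrib, ← Finset.sum_mul] at h1
    linarith

theorem dom_sum_le {n : ℕ} (a b f : Fin n → ℝ)
    (hab : ∀ m : Fin n, ∑ i ∈ univ.filter (fun i => m ≤ i), a i ≤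
      ∑ i ∈ univ.filter (fun i => m ≤ i), b i)
    (hs : ∑ i, a i = ∑ i, b i) (hf : Monotone f) :
    ∑ i, a i * f i ≤ ∑ i, b i * f i := by
  cases n with
  | zero => simp
  | succ n =>
    have h := tail_nonneg_aux (n + 1) (fun i => b i - a i) (fun i => f i - f 0)
      (by intro m; have := hab m; simp only [Finset.sum_sub_distrib]; linarith)
      (by intro i j hij; have := hf hij; simpa using this)
      (by intro i; have := hf (Fin.zero_le i); simpa using this)
    simp only [mul_sub, sub_mul, Finset.sum_sub_distrib, ← Finset.sum_mul] at h
    rw [hs] at h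
    linarith

theorem cst_submod (p hc y y' a b : ℝ) (hp : 0 < p) (hhc : 0 < hc) (hy : y ≤ y') (hab : a ≤ b) :
    cst p hc y a - cst p hc y' a ≤ cst p hc y b - cst p hc y' b := by
  unfold cst
  have h1 : 0 ≤ max (b - y) 0 - max (b - y') 0 - max (a - y) 0 + max (a - y') 0 := by
    rcases max_cases (b - y) 0 with h | h <;> rcases max_cases (b - y') 0 with h' | h' <;>
    rcases max_cases (a - y) 0 with g | g <;> rcases max_cases (a - y') 0 with g' | g' <;>
    linarith
  have h2 : 0 ≤ max (y - b) 0 - max (y' - b) 0 - max (y - a) 0 + max (y' - a) 0 := by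
    rcases max_cases (y - b) 0 with h | h <;> rcases max_cases (y' - b) 0 with h' | h' <;>
    rcases max_cases (y - a) 0 with g | g <;> rcases max_cases (y' - a) 0 with g' | g' <;>
    linarith
  have := mul_nonneg hp.le h1
  have := mul_nonneg hhc.le h2
  linarith

theorem sum_sig (P : Fin M → Z → Matrix (Fin N) (Fin N) ℝ) (x : Fin N → ℝ) (S : Finset (Fin M)) :
    ∑ k ∈ S, sig P k x = ∑ i, x i * ∑ k ∈ S, ∑ j, ∑ z, P k z i j := by
  have h : ∀ k, sig P k x = ∑ i, x i * ∑ j, ∑ z, P k z i j := by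
    intro k
    unfold sig sigz
    rw [Finset.sum_comm]
    refine Finset.sum_congr rfl fun i _ => ?_
    rw [← Finset.mul_sum, Finset.sum_comm]
  simp only [h]
  rw [Finset.sum_comm]
  exact Finset.sum_congr rfl fun i _ => (Finset.mul_sum _ _ _).symm

theorem sStar_spec (P : Fin M → Z → Matrix (Fin N) (Fin N) ℝ) (d : Fin M → ℤ) (p hc : ℝ)
    (x : Fin N → ℝ) (hM : 1 ≤ M) :
    (∃ m : Fin M, sStar P d p hc x = d m ∧
      ∀ k : Fin M, Lf P d p hc x (d m : ℝ) ≤ Lf P d p hc x (d k : ℝ)) ∧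
    ∀ m : Fin M, (∀ k : Fin M, Lf P d p hc x (d m : ℝ) ≤ Lf P d p hc x (d k : ℝ)) →
      sStar P d p hc x ≤ d m := by
  have hbdd : BddBelow {t : ℤ | ∃ m : Fin M, t = d m ∧
      ∀ k : Fin M, Lf P d p hc x (d m : ℝ) ≤ Lf P d p hc x (d k : ℝ)} := by
    refine ((Set.finite_range d).subset ?_).bddBelow
    rintro t ⟨m, rfl, _⟩
    exact ⟨m, rfl⟩
  refine ⟨?_, fun m hm => csInf_le hbdd ⟨m, rfl, hm⟩⟩
  haveI : Nonempty (Fin M) := ⟨⟨0, hM⟩⟩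
  obtain ⟨m, hm⟩ := Finite.exists_min fun m : Fin M => Lf P d p hc x (d m : ℝ)
  have hne : {t : ℤ | ∃ m : Fin M, t = d m ∧
      ∀ k : Fin M, Lf P d p hc x (d m : ℝ) ≤ Lf P d p hc x (d k : ℝ)}.Nonempty :=
    ⟨d m, m, rfl, hm⟩
  exact Int.csInf_mem hne hbdd

/-- Lemma 5: under Assumption A3, `s*` is monotone with respect to
first-order stochastic dominance on the belief space. -/
theorem stmt2 {N M : ℕ} {Z : Type*} [Fintype Z] [Nonempty Z]
    (hN : 1 ≤ N) (hM : 1 ≤ M)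
    (d : Fin M → ℤ) (hd : StrictMono d)
    (P : Fin M → Z → Matrix (Fin N) (Fin N) ℝ)
    (hPnn : ∀ k z i j, 0 ≤ P k z i j)
    (hPst : ∀ i : Fin N, ∑ k : Fin M, ∑ z : Z, ∑ j : Fin N, P k z i j = 1)
    (p hc : ℝ) (hp : 0 < p) (hhc : 0 < hc)
    (hA3 : A3 P)
    (x x' : Fin N → ℝ) (hx : memX N x) (hx' : memX N x') (hdom : sdom x x') :
    sStar P d p hc x ≤ sStar P d p hc x' := by
  obtain ⟨⟨m, hm, hmin⟩, hleast⟩ := sStar_spec P d p hc x hM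
  obtain ⟨⟨m', hm', hmin'⟩, -⟩ := sStar_spec P d p hc x' hM
  by_contra hlt
  push Not at hlt
  have hy : (d m' : ℝ) ≤ d m := by
    have : d m' < d m := by rw [← hm, ← hm']; exact hlt
    exact_mod_cast this.le
  have htot : ∀ w : Fin N → ℝ, memX N w → ∑ k, sig P k w = 1 := by
    intro w hw
    rw [sum_sig]
    have : ∀ i : Fin N, ∑ k : Fin M, ∑ j, ∑ z, P k z i j = 1 := by
      intro i
      rw [← hPst i]
      exact Finset.sum_congr rfl fun k _ => Finset.sum_comm
    simp only [this, mul_one]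
    exact hw.2
  have key := dom_sum_le (fun k => sig P k x) (fun k => sig P k x')
    (fun k => cst p hc (d m') (d k) - cst p hc (d m) (d k))
    (by
      intro n
      simp only [sum_sig]
      exact dom_sum_le x x' _ hdom (hx.2.trans hx'.2.symm) (fun i i' hi => hA3 i i' hi n))
    ((htot x hx).trans (htot x' hx').symm)
    (fun k k' hk => cst_submod p hc _ _ _ _ hp hhc hy (by exact_mod_cast hd.monotone hk))
  simp only [mul_sub, Finset.sum_sub_distrib] at key
  change Lf P d p hc x (d m') - Lf P d p hc x (d m) ≤
    Lf P d p hc x' (d m') - Lf P d p hc x' (d m) at key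
  have h1 := hmin' m
  have h2 := hleast m' (fun k => by have := hmin k; linarith)
  omega

end InvCtrl
end
end

section
/- Fix d ∈ {d_1,…,d_M} and z ∈ Z with σ(d,z,e_i) > 0 for every i = 1,…,N. Define x̂ = x̂^{d,z} ∈ ℝ^N by: x̂_N = min_{1≤i≤N} λ_N(d,z,e_i); x̂_n = min_{1≤i≤N} ∑_{k=n}^N λ_k(d,z,e_i) − ∑_{k=n+1}^N x̂_k for n = N−1,…,2; and x̂_1 = 1 − ∑_{k=2}^N x̂_k. Then x̂ ∈ X, and x̂ ⪯ λ(d,z,x) for every x ∈ X. -/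
open Finset

noncomputable section

open scoped Classical

namespace InvCtrl

variable {N M : ℕ} {Z : Type*}

variable [Fintype Z]

/-- `Tmin P k z n = min_{1 ≤ i ≤ N} ∑_{j ≥ n} λ_j(d_k, z, e_i)` (0-indexed tail sums of the
posteriors of the extreme beliefs). -/
def Tmin (P : Fin M → Z → Matrix (Fin N) (Fin N) ℝ) (k : Fin M) (z : Z) (n : ℕ) : ℝ :=
  sInf {r : ℝ | ∃ i : Fin N,
    r = ∑ j ∈ univ.filter (fun j : Fin N => n ≤ (j : ℕ)), lam P k z (eV N i) j}

/-- The vector `x̂ = x̂^{d,z}` defined by the downward recursion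
`x̂_N = min_i λ_N(d,z,e_i)`, `x̂_n = min_i ∑_{k=n}^N λ_k(d,z,e_i) − ∑_{k=n+1}^N x̂_k`,
`x̂_1 = 1 − ∑_{k=2}^N x̂_k`; equivalently its tail sums are `Tmin` (and total mass 1). -/
def xhat (P : Fin M → Z → Matrix (Fin N) (Fin N) ℝ) (k : Fin M) (z : Z) : Fin N → ℝ :=
  fun n => if (n : ℕ) = 0 then 1 - Tmin P k z 1 else Tmin P k z (n : ℕ) - Tmin P k z ((n : ℕ) + 1)

theorem sigz_eV (P : Fin M → Z → Matrix (Fin N) (Fin N) ℝ) (k : Fin M) (z : Z) (i : Fin N) :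
    sigz P k z (eV N i) = ∑ j, P k z i j := by
  simp [sigz, eV]

theorem lam_eV (P : Fin M → Z → Matrix (Fin N) (Fin N) ℝ) (k : Fin M) (z : Z) (i j : Fin N) :
    lam P k z (eV N i) j = P k z i j / ∑ j, P k z i j := by
  simp [lam, sigz_eV, eV]

theorem tele (f : ℕ → ℝ) (n N : ℕ) :
    ∑ i ∈ range N, (if n ≤ i then f i - f (i + 1) else 0) = if n ≤ N then f n - f N else 0 := by
  induction N with
  | zero =>
    by_cases h : n ≤ 0
    · have : n = 0 := by omega
      simp [this]
    · simp [h]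
  | succ N ih =>
    rw [sum_range_succ, ih]
    by_cases h : n ≤ N
    · have h' : n ≤ N + 1 := by omega
      simp [h, h']
    · by_cases h' : n ≤ N + 1
      · have : n = N + 1 := by omega
        simp [this]
      · simp [h, h']

theorem tele_fin (f : ℕ → ℝ) (n N : ℕ) (hn : n ≤ N) :
    ∑ i ∈ univ.filter (fun i : Fin N => n ≤ (i : ℕ)), (f i - f (i + 1)) = f n - f N := by
  rw [sum_filter, Fin.sum_univ_eq_sum_range (fun i => if n ≤ i then f i - f (i + 1) else 0) N,
    tele, if_pos hn]

/-- Lemma 8(i) and the construction of `x̂^{d,z}`: `x̂^{d,z} ∈ X` and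
`x̂^{d,z} ⪯ λ(d,z,x)` for every `x ∈ X`. -/
theorem stmt5 {N M : ℕ} {Z : Type*} [Fintype Z] [Nonempty Z]
    (hN : 1 ≤ N) (hM : 1 ≤ M)
    (d : Fin M → ℤ) (hd : StrictMono d)
    (P : Fin M → Z → Matrix (Fin N) (Fin N) ℝ)
    (hPnn : ∀ k z i j, 0 ≤ P k z i j)
    (hPst : ∀ i : Fin N, ∑ k : Fin M, ∑ z : Z, ∑ j : Fin N, P k z i j = 1)
    (k : Fin M) (z : Z)
    (hpos : ∀ i : Fin N, 0 < sigz P k z (eV N i)) :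
    memX N (xhat P k z) ∧
    ∀ x : Fin N → ℝ, memX N x → sdom (xhat P k z) (lam P k z x) := by
  have hs : ∀ i, 0 < ∑ j, P k z i j := fun i => by rw [← sigz_eV]; exact hpos i
  have hne : ∀ n, {r : ℝ | ∃ i : Fin N,
      r = ∑ j ∈ univ.filter (fun j : Fin N => n ≤ (j : ℕ)), lam P k z (eV N i) j}.Nonempty :=
    fun n => ⟨_, ⟨0, hN⟩, rfl⟩
  have hlnn : ∀ i j, 0 ≤ lam P k z (eV N i) j := fun i j => by
    rw [lam_eV]; exact div_nonneg (hPnn _ _ _ _) (hs i).le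
  have hle : ∀ n i, Tmin P k z n ≤
      ∑ j ∈ univ.filter (fun j : Fin N => n ≤ (j : ℕ)), lam P k z (eV N i) j := by
    intro n i
    refine csInf_le ⟨0, ?_⟩ ⟨i, rfl⟩
    rintro r ⟨i', rfl⟩
    exact sum_nonneg fun j _ => hlnn i' j
  have hT0 : Tmin P k z 0 = 1 := by
    have h1 : ∀ i : Fin N,
        ∑ j ∈ univ.filter (fun j : Fin N => 0 ≤ (j : ℕ)), lam P k z (eV N i) j = 1 := by
      intro i
      simp only [lam_eV, Nat.zero_le, filter_true]
      rw [← sum_div, div_self (hs i).ne']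
    refine le_antisymm ((hle 0 ⟨0, hN⟩).trans (h1 _).le) (le_csInf (hne 0) ?_)
    rintro r ⟨i, rfl⟩
    exact (h1 i).ge
  have hTN : Tmin P k z N = 0 := by
    have h1 : ∀ i : Fin N,
        ∑ j ∈ univ.filter (fun j : Fin N => N ≤ (j : ℕ)), lam P k z (eV N i) j = 0 := by
      intro i
      refine sum_eq_zero fun j hj => ?_
      have := (mem_filter.1 hj).2
      have := j.2
      omega
    refine le_antisymm ((hle N ⟨0, hN⟩).trans (h1 _).le) (le_csInf (hne N) ?_)
    rintro r ⟨i, rfl⟩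
    exact (h1 i).ge
  have hanti : ∀ n, Tmin P k z (n + 1) ≤ Tmin P k z n := by
    intro n
    refine le_csInf (hne n) ?_
    rintro r ⟨i, rfl⟩
    refine (hle (n + 1) i).trans (sum_le_sum_of_subset_of_nonneg ?_ fun j _ _ => hlnn i j)
    intro j hj
    simp only [mem_filter, mem_univ, true_and] at hj ⊢
    omega
  have hx : ∀ n : Fin N, xhat P k z n = Tmin P k z (n : ℕ) - Tmin P k z ((n : ℕ) + 1) := by
    intro n
    unfold xhat
    split_ifs with h
    · rw [h, hT0]
    · rfl
  have htail : ∀ n ≤ N, ∑ i ∈ univ.filter (fun i : Fin N => n ≤ (i : ℕ)), xhat P k z i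
      = Tmin P k z n := by
    intro n hn
    simp only [hx]
    rw [tele_fin (Tmin P k z) n N hn, hTN, sub_zero]
  refine ⟨⟨fun i => ?_, ?_⟩, ?_⟩
  · rw [hx]; exact sub_nonneg.2 (hanti _)
  · have := htail 0 (Nat.zero_le _)
    simpa [hT0] using this
  · rintro x ⟨hx0, hx1⟩ n
    have hσ : 0 < sigz P k z x := by
      unfold sigz
      obtain ⟨i, -, hi⟩ : ∃ i ∈ univ, 0 < x i := by
        by_contra! h
        have := sum_nonpos h
        linarith
      exact sum_pos' (fun i _ => mul_nonneg (hx0 i) (hs i).le)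
        ⟨i, mem_univ _, mul_pos hi (hs i)⟩
    have h1 := htail n n.2.le
    simp only [Fin.le_def]
    rw [h1]
    simp only [lam]
    rw [← sum_div, le_div_iff₀ hσ, sum_comm, sigz, mul_sum]
    refine sum_le_sum fun i _ => ?_
    rw [← mul_sum]
    have h2 := hle n i
    simp only [lam_eV] at h2
    rw [← sum_div, le_div_iff₀ (hs i)] at h2
    calc _ = x i * (Tmin P k z n * ∑ j, P k z i j) := by ring
      _ ≤ _ := mul_le_mul_of_nonneg_left h2 (hx0 i)

end InvCtrl
end
end

section
/- Fix d ∈ {d_1,…,d_M} and z ∈ Z with σ(d,z,e_i) > 0 for every i = 1,…,N, and suppose Assumption A3 holds. Then for every x' ∈ X satisfying x' ⪯ λ(d,z,x) for all x ∈ X, one has s*(x') ≤ s*(x̂^{d,z}). -/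
open Finset

noncomputable section

open scoped Classical

namespace InvCtrl

variable {N M : ℕ} {Z : Type*}

variable [Fintype Z]

theorem abel_nn : ∀ (n : ℕ) (w f : Fin n → ℝ), Monotone f → (∀ i, 0 ≤ f i) →
    (∀ m : Fin n, 0 ≤ ∑ i ∈ univ.filter (fun i => m ≤ i), w i) → 0 ≤ ∑ i, w i * f i := by
  intro n
  induction n with
  | zero => intro w f _ _ _; simp
  | succ n ih =>
    intro w f hf h0 hw
    have h1 := ih (fun i => w i.succ) (fun i => f i.succ - f 0)
      (fun a b hab => by
        have := hf (Fin.succ_le_succ_iff.mpr hab)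
        simp only
        linarith)
      (fun i => sub_nonneg.mpr (hf (Fin.zero_le _)))
      (fun m => by
        have := hw m.succ
        rw [Finset.sum_filter, Fin.sum_univ_succ] at this
        rw [Finset.sum_filter]
        simpa using this)
    have h2 := hw 0
    have h3 : univ.filter (fun i : Fin (n+1) => 0 ≤ i) = univ := by
      ext i; simp
    rw [h3, Fin.sum_univ_succ] at h2
    rw [Fin.sum_univ_succ]
    have h4 := mul_nonneg (h0 0) h2
    have h5 : ∑ i : Fin n, w i.succ * (f i.succ - f 0)
        = ∑ i : Fin n, w i.succ * f i.succ - (∑ i : Fin n, w i.succ) * f 0 := by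
      rw [Finset.sum_mul, ← Finset.sum_sub_distrib]
      exact Finset.sum_congr rfl fun i _ => by ring
    rw [h5] at h1
    linarith

theorem abel_mono {n : ℕ} (u v f : Fin n → ℝ) (hf : Monotone f)
    (ht : sdom u v) (hs : ∑ i, u i = ∑ i, v i) :
    ∑ i, u i * f i ≤ ∑ i, v i * f i := by
  rcases n with _ | n
  · simp
  have h := abel_nn (n+1) (fun i => v i - u i) (fun i => f i - f 0)
    (fun a b hab => by
      have := hf hab
      simp only
      linarith)
    (fun i => sub_nonneg.mpr (hf (Fin.zero_le _)))
    (fun m => by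
      rw [Finset.sum_sub_distrib]
      exact sub_nonneg.mpr (ht m))
  have h5 : ∑ i, (v i - u i) * (f i - f 0)
      = ∑ i, v i * f i - ∑ i, u i * f i - (∑ i, v i - ∑ i, u i) * f 0 := by
    rw [sub_mul, Finset.sum_mul, Finset.sum_mul, ← Finset.sum_sub_distrib,
      ← Finset.sum_sub_distrib, ← Finset.sum_sub_distrib]
    exact Finset.sum_congr rfl fun i _ => by ring
  rw [h5, hs] at h
  linarith

theorem sig_eq (P : Fin M → Z → Matrix (Fin N) (Fin N) ℝ) (k : Fin M) (x : Fin N → ℝ) :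
    sig P k x = ∑ i, x i * ∑ j, ∑ z, P k z i j := by
  unfold sig sigz
  rw [Finset.sum_comm]
  refine Finset.sum_congr rfl fun i _ => ?_
  rw [← Finset.mul_sum, Finset.sum_comm]

theorem sum_sig_eq (P : Fin M → Z → Matrix (Fin N) (Fin N) ℝ) (s : Finset (Fin M))
    (x : Fin N → ℝ) :
    ∑ k ∈ s, sig P k x = ∑ i, x i * ∑ k ∈ s, ∑ j, ∑ z, P k z i j := by
  simp only [sig_eq]
  rw [Finset.sum_comm]
  exact Finset.sum_congr rfl fun i _ => by rw [Finset.mul_sum]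

theorem sig_dom (P : Fin M → Z → Matrix (Fin N) (Fin N) ℝ) (hA3 : A3 P)
    (hPst : ∀ i : Fin N, ∑ k : Fin M, ∑ z : Z, ∑ j : Fin N, P k z i j = 1)
    (x y : Fin N → ℝ) (hxy : sdom x y) (hs : ∑ i, x i = ∑ i, y i) :
    sdom (fun k => sig P k x) (fun k => sig P k y) ∧ ∑ k, sig P k x = ∑ k, sig P k y := by
  constructor
  · intro m
    simp only
    rw [sum_sig_eq, sum_sig_eq]
    exact abel_mono x y _ (fun i i' h => hA3 i i' h m) hxy hs
  · rw [sum_sig_eq, sum_sig_eq]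
    have : ∀ i : Fin N, ∑ k : Fin M, ∑ j, ∑ z, P k z i j = 1 := fun i => by
      rw [← hPst i]
      exact Finset.sum_congr rfl fun k _ => Finset.sum_comm
    simp only [this, mul_one, hs]

theorem cst_anti (p hc : ℝ) (hp : 0 < p) (hhc : 0 < hc) (a b s t : ℝ) (hab : a ≤ b) (hst : s ≤ t) :
    cst p hc a s - cst p hc b s ≤ cst p hc a t - cst p hc b t := by
  unfold cst
  have h1 : max (s - a) 0 - max (s - b) 0 ≤ max (t - a) 0 - max (t - b) 0 := by
    rcases max_cases (s - a) 0 with h | h <;> rcases max_cases (s - b) 0 with h' | h' <;>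
    rcases max_cases (t - a) 0 with g | g <;> rcases max_cases (t - b) 0 with g' | g' <;> linarith
  have h2 : max (a - s) 0 - max (b - s) 0 ≤ max (a - t) 0 - max (b - t) 0 := by
    rcases max_cases (a - s) 0 with h | h <;> rcases max_cases (b - s) 0 with h' | h' <;>
    rcases max_cases (a - t) 0 with g | g <;> rcases max_cases (b - t) 0 with g' | g' <;> linarith
  have h3 := mul_le_mul_of_nonneg_left h1 hp.le
  have h4 := mul_le_mul_of_nonneg_left h2 hhc.le
  linarith

theorem Lf_diff (P : Fin M → Z → Matrix (Fin N) (Fin N) ℝ) (d : Fin M → ℤ) (p hc : ℝ)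
    (x : Fin N → ℝ) (a b : ℝ) :
    Lf P d p hc x a - Lf P d p hc x b
      = ∑ k, sig P k x * (cst p hc a (d k : ℝ) - cst p hc b (d k : ℝ)) := by
  unfold Lf
  rw [← Finset.sum_sub_distrib]
  exact Finset.sum_congr rfl fun k _ => by ring

theorem sStar_bdd (P : Fin M → Z → Matrix (Fin N) (Fin N) ℝ) (d : Fin M → ℤ) (p hc : ℝ)
    (x : Fin N → ℝ) : BddBelow {t : ℤ | ∃ m : Fin M, t = d m ∧
      ∀ k : Fin M, Lf P d p hc x (d m : ℝ) ≤ Lf P d p hc x (d k : ℝ)} := by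
  refine (Set.finite_range d).bddBelow.mono ?_
  rintro t ⟨m, rfl, _⟩
  exact ⟨m, rfl⟩

theorem sStar_mem (hM : 1 ≤ M) (P : Fin M → Z → Matrix (Fin N) (Fin N) ℝ) (d : Fin M → ℤ)
    (p hc : ℝ) (x : Fin N → ℝ) : ∃ m : Fin M, sStar P d p hc x = d m ∧
      ∀ k : Fin M, Lf P d p hc x (d m : ℝ) ≤ Lf P d p hc x (d k : ℝ) := by
  have : Nonempty (Fin M) := ⟨⟨0, hM⟩⟩
  obtain ⟨m, hm⟩ := Finite.exists_min (fun m : Fin M => Lf P d p hc x (d m : ℝ))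
  have hne : {t : ℤ | ∃ m : Fin M, t = d m ∧
      ∀ k : Fin M, Lf P d p hc x (d m : ℝ) ≤ Lf P d p hc x (d k : ℝ)}.Nonempty :=
    ⟨d m, m, rfl, hm⟩
  exact Int.csInf_mem hne (sStar_bdd P d p hc x)

theorem sStar_mono (hM : 1 ≤ M) (P : Fin M → Z → Matrix (Fin N) (Fin N) ℝ) (d : Fin M → ℤ)
    (hd : StrictMono d) (p hc : ℝ) (hp : 0 < p) (hhc : 0 < hc) (hA3 : A3 P)
    (hPst : ∀ i : Fin N, ∑ k : Fin M, ∑ z : Z, ∑ j : Fin N, P k z i j = 1)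
    (x y : Fin N → ℝ) (hxy : sdom x y) (hs : ∑ i, x i = ∑ i, y i) :
    sStar P d p hc x ≤ sStar P d p hc y := by
  obtain ⟨m', h', hm'⟩ := sStar_mem hM P d p hc x
  obtain ⟨m, h, hm⟩ := sStar_mem hM P d p hc y
  by_contra! hlt
  rw [h, h'] at hlt
  obtain ⟨g1, g2⟩ := sig_dom P hA3 hPst x y hxy hs
  have key := abel_mono (fun k => sig P k x) (fun k => sig P k y)
    (fun k => cst p hc (d m : ℝ) (d k : ℝ) - cst p hc (d m' : ℝ) (d k : ℝ))
    (fun a b hab => cst_anti p hc hp hhc _ _ _ _ (by exact_mod_cast hlt.le)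
      (by exact_mod_cast hd.monotone hab)) g1 g2
  rw [← Lf_diff, ← Lf_diff] at key
  have h6 := hm m'
  have : sStar P d p hc x ≤ d m :=
    csInf_le (sStar_bdd P d p hc x) ⟨m, rfl, fun k => by have := hm' k; linarith⟩
  omega

theorem fin_tail (F : ℕ → ℝ) (n : ℕ) :
    ∑ j ∈ univ.filter (fun j : Fin N => n ≤ (j : ℕ)), F j = ∑ j ∈ Finset.Ico n N, F j := by
  rw [Finset.sum_filter, Fin.sum_univ_eq_sum_range (fun j => if n ≤ j then F j else 0),
    ← Finset.sum_filter]
  refine Finset.sum_congr ?_ fun _ _ => rfl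
  ext j; simp; omega

theorem Tmin_top (hN : 1 ≤ N) (P : Fin M → Z → Matrix (Fin N) (Fin N) ℝ) (k : Fin M) (z : Z) :
    Tmin P k z N = 0 := by
  unfold Tmin
  have h : univ.filter (fun j : Fin N => N ≤ (j : ℕ)) = ∅ := by
    ext j; simp
  have : {r : ℝ | ∃ i : Fin N,
      r = ∑ j ∈ univ.filter (fun j : Fin N => N ≤ (j : ℕ)), lam P k z (eV N i) j} = {0} := by
    ext r
    simp only [h, Finset.sum_empty, Set.mem_setOf_eq, Set.mem_singleton_iff]
    exact ⟨fun ⟨_, h⟩ => h, fun h => ⟨⟨0, hN⟩, h⟩⟩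
  rw [this, csInf_singleton]

theorem xhat_tail (hN : 1 ≤ N) (P : Fin M → Z → Matrix (Fin N) (Fin N) ℝ) (k : Fin M) (z : Z)
    (n : ℕ) (hn : 1 ≤ n) (hnN : n ≤ N) :
    ∑ j ∈ univ.filter (fun j : Fin N => n ≤ (j : ℕ)), xhat P k z j = Tmin P k z n := by
  unfold xhat
  rw [fin_tail (fun j => if j = 0 then 1 - Tmin P k z 1 else Tmin P k z j - Tmin P k z (j+1)) n]
  have : ∀ j ∈ Finset.Ico n N, (if j = 0 then 1 - Tmin P k z 1 else
      Tmin P k z j - Tmin P k z (j+1)) = -(Tmin P k z (j+1) - Tmin P k z j) := by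
    intro j hj
    rw [Finset.mem_Ico] at hj
    rw [if_neg (by omega)]; ring
  rw [Finset.sum_congr rfl this, Finset.sum_neg_distrib, Finset.sum_Ico_sub _ hnN,
    Tmin_top hN P k z]
  ring

theorem xhat_sum (hN : 1 ≤ N) (P : Fin M → Z → Matrix (Fin N) (Fin N) ℝ) (k : Fin M) (z : Z) :
    ∑ j, xhat P k z j = 1 := by
  have h1 := xhat_tail hN P k z 1 le_rfl hN
  obtain ⟨n, rfl⟩ : ∃ n, N = n + 1 := ⟨N - 1, by omega⟩
  rw [Finset.sum_filter, Fin.sum_univ_succ] at h1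
  rw [Fin.sum_univ_succ]
  have h2 : xhat P k z 0 = 1 - Tmin P k z 1 := by simp [xhat]
  simp at h1
  rw [h1, h2]
  ring

theorem eV_mem (i : Fin N) : memX N (eV N i) := by
  constructor
  · intro j; unfold eV; split_ifs <;> norm_num
  · simp [eV]

/-- Lemma 8(ii): under Assumption A3, `x̂^{d,z}` maximizes the myopic
base stock level among all vectors dominated by every attainable posterior. -/
theorem stmt6 {N M : ℕ} {Z : Type*} [Fintype Z] [Nonempty Z]
    (hN : 1 ≤ N) (hM : 1 ≤ M)
    (d : Fin M → ℤ) (hd : StrictMono d)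
    (P : Fin M → Z → Matrix (Fin N) (Fin N) ℝ)
    (hPnn : ∀ k z i j, 0 ≤ P k z i j)
    (hPst : ∀ i : Fin N, ∑ k : Fin M, ∑ z : Z, ∑ j : Fin N, P k z i j = 1)
    (p hc : ℝ) (hp : 0 < p) (hhc : 0 < hc)
    (k : Fin M) (z : Z)
    (hpos : ∀ i : Fin N, 0 < sigz P k z (eV N i))
    (hA3 : A3 P) :
    ∀ x' : Fin N → ℝ, memX N x' →
      (∀ x : Fin N → ℝ, memX N x → sdom x' (lam P k z x)) →
      sStar P d p hc x' ≤ sStar P d p hc (xhat P k z) := by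
  intro x' hx' hdom
  have hs : ∑ i, x' i = ∑ i, xhat P k z i := by rw [hx'.2, xhat_sum hN]
  refine sStar_mono hM P d hd p hc hp hhc hA3 hPst x' _ (fun n => ?_) hs
  by_cases hn : (n : ℕ) = 0
  · have : univ.filter (fun i : Fin N => n ≤ i) = univ := by
      ext i; simp [Fin.le_def, hn]
    rw [this, hs]
  · have h := xhat_tail hN P k z n (by omega) n.2.le
    simp only [Fin.le_def]
    rw [h]
    unfold Tmin
    refine le_csInf ⟨_, ⟨0, hN⟩, rfl⟩ ?_
    rintro r ⟨i, rfl⟩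
    simpa only [Fin.le_def] using hdom _ (eV_mem i) n

end InvCtrl
end
end

section
/- Suppose f : ℤ × {d_1,…,d_M} → ℤ is such that for each d, the map y ↦ f(y,d) is nondecreasing and convex (i.e., y ↦ f(y+1,d) − f(y,d) is nondecreasing), and suppose Assumption A1 holds. Then for every n ≥ 0 and every x ∈ X: (a) v_n(x,s) = v_n(x, max{s*(x), s}) for every s ∈ ℤ; (b) the map s ↦ v_n(x,s) is nondecreasing and convex on ℤ; and (c) the myopic base stock action attains the infimum: for every s ∈ ℤ, v_{n+1}(x,s) = L(x, y*) + β ∑_{(d_k,z): σ(d_k,z,x) ≠ 0} σ(d_k,z,x) · v_n(λ(d_k,z,x), f(y*, d_k)), where y* = max{s*(x), s}. -/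
open Finset

noncomputable section

open scoped Classical

namespace InvCtrl

variable {N M : ℕ} {Z : Type*}

variable [Fintype Z]

/-- Finite-horizon value iteration: `v_0 = 0` and
`v_{n+1}(x,s) = inf_{y ≥ s, y ∈ ℤ} [ L(x,y) + β ∑_{(d_k,z) : σ(d_k,z,x) ≠ 0} σ(d_k,z,x)
v_n(λ(d_k,z,x), f(y,d_k)) ]`, for a general transition `f` of the inventory position. -/
def vIter (P : Fin M → Z → Matrix (Fin N) (Fin N) ℝ) (d : Fin M → ℤ) (p hc β : ℝ)
    (f : ℤ → ℤ → ℤ) : ℕ → (Fin N → ℝ) → ℤ → ℝ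
  | 0, _, _ => 0
  | n + 1, x, s =>
    sInf {r : ℝ | ∃ y : ℤ, s ≤ y ∧
      r = Lf P d p hc x (y : ℝ) + β * ∑ k, ∑ z,
        (if sigz P k z x = 0 then 0
         else sigz P k z x * vIter P d p hc β f n (lam P k z x) (f y (d k)))}

lemma aux_mono (Q : ℤ → ℝ) (t : ℤ)
    (hc : ∀ s s' : ℤ, s ≤ s' → Q (s + 1) - Q s ≤ Q (s' + 1) - Q s')
    (hm : ∀ y, Q t ≤ Q y) : ∀ y y' : ℤ, t ≤ y → y ≤ y' → Q y ≤ Q y' := by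
  intro y y' hy hyy
  induction y', hyy using Int.le_induction with
  | base => exact le_rfl
  | succ n hn ih =>
    have h1 := hc t n (hy.trans hn)
    have h2 := hm (t + 1)
    linarith

lemma aux_inf (Q : ℤ → ℝ) (t : ℤ)
    (hc : ∀ s s' : ℤ, s ≤ s' → Q (s + 1) - Q s ≤ Q (s' + 1) - Q s')
    (hm : ∀ y, Q t ≤ Q y) (s : ℤ) :
    sInf {r : ℝ | ∃ y : ℤ, s ≤ y ∧ r = Q y} = Q (max t s) := by
  apply IsLeast.csInf_eq
  refine ⟨⟨max t s, le_max_right _ _, rfl⟩, ?_⟩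
  rintro r ⟨y, hy, rfl⟩
  rcases le_total t s with h | h
  · rw [max_eq_right h]
    exact aux_mono Q t hc hm s y h hy
  · rw [max_eq_left h]
    exact hm y

lemma aux_conv_max (Q : ℤ → ℝ) (t : ℤ)
    (hc : ∀ s s' : ℤ, s ≤ s' → Q (s + 1) - Q s ≤ Q (s' + 1) - Q s')
    (hm : ∀ y, Q t ≤ Q y) (s s' : ℤ) (h : s ≤ s') :
    Q (max t (s + 1)) - Q (max t s) ≤ Q (max t (s' + 1)) - Q (max t s') := by
  rcases lt_or_ge s t with h1 | h1
  · rw [max_eq_left h1.le, max_eq_left (show s + 1 ≤ t by omega)]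
    have := aux_mono Q t hc hm (max t s') (max t (s' + 1)) (le_max_left _ _) (by omega)
    linarith
  · rw [max_eq_right h1, max_eq_right (show t ≤ s + 1 by omega),
      max_eq_right (show t ≤ s' by omega), max_eq_right (show t ≤ s' + 1 by omega)]
    exact hc s s' h

lemma aux_comp (v : ℤ → ℝ) (hv : ∀ s s' : ℤ, s ≤ s' → v s ≤ v s')
    (hc : ∀ s s' : ℤ, s ≤ s' → v (s + 1) - v s ≤ v (s' + 1) - v s')
    (a b a' b' : ℤ) (hab : a ≤ b) (haa : a ≤ a') (h : b - a ≤ b' - a') :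
    v b - v a ≤ v b' - v a' := by
  have key : ∀ n : ℕ, v (a + n) - v a ≤ v (a' + n) - v a' := by
    intro n
    induction n with
    | zero => simp
    | succ n ih =>
      have := hc (a + n) (a' + n) (by omega)
      push_cast
      rw [← add_assoc, ← add_assoc]
      linarith
  have h1 := key (b - a).toNat
  rw [Int.toNat_of_nonneg (by omega)] at h1
  have h2 := hv (a' + (b - a)) b' (by omega)
  rw [show a + (b - a) = b by ring] at h1
  linarith

lemma cst_conv (p hc : ℝ) (hp : 0 < p) (hhc : 0 < hc) (e s s' : ℤ) (h : s ≤ s') :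
    cst p hc ((s + 1 : ℤ) : ℝ) e - cst p hc (s : ℝ) e ≤
      cst p hc ((s' + 1 : ℤ) : ℝ) e - cst p hc (s' : ℝ) e := by
  have key : ∀ u : ℤ, cst p hc ((u + 1 : ℤ) : ℝ) e - cst p hc (u : ℝ) e =
      if u < e then -p else hc := by
    intro u
    unfold cst
    split_ifs with hu
    · have : (u : ℝ) + 1 ≤ e := by exact_mod_cast hu
      push_cast
      rw [max_eq_left (by linarith), max_eq_right (by linarith), max_eq_left (by linarith),
        max_eq_right (by linarith)]
      ring
    · have : (e : ℝ) ≤ u := by exact_mod_cast (not_lt.mp hu)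
      push_cast
      rw [max_eq_right (by linarith), max_eq_left (by linarith), max_eq_right (by linarith),
        max_eq_left (by linarith)]
      ring
  rw [key, key]
  split_ifs <;> first | linarith | omega

lemma cst_affine (p hc : ℝ) (a b y e : ℝ) (hay : a ≤ y) (hyb : y ≤ b)
    (h : e ≤ a ∨ b ≤ e) :
    (b - y) * cst p hc a e + (y - a) * cst p hc b e = (b - a) * cst p hc y e := by
  unfold cst
  rcases h with h | h
  · rw [max_eq_right (show e - a ≤ 0 by linarith), max_eq_right (show e - b ≤ 0 by linarith),
      max_eq_right (show e - y ≤ 0 by linarith), max_eq_left (show 0 ≤ a - e by linarith),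
      max_eq_left (show 0 ≤ b - e by linarith), max_eq_left (show 0 ≤ y - e by linarith)]
    ring
  · rw [max_eq_left (show 0 ≤ e - a by linarith), max_eq_left (show 0 ≤ e - b by linarith),
      max_eq_left (show 0 ≤ e - y by linarith), max_eq_right (show a - e ≤ 0 by linarith),
      max_eq_right (show b - e ≤ 0 by linarith), max_eq_right (show y - e ≤ 0 by linarith)]
    ring

lemma sigz_nonneg (P : Fin M → Z → Matrix (Fin N) (Fin N) ℝ)
    (hPnn : ∀ k z i j, 0 ≤ P k z i j) (x : Fin N → ℝ) (hx : memX N x) (k : Fin M) (z : Z) :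
    0 ≤ sigz P k z x :=
  Finset.sum_nonneg fun i _ => mul_nonneg (hx.1 i) (Finset.sum_nonneg fun j _ => hPnn k z i j)

lemma lam_mem (P : Fin M → Z → Matrix (Fin N) (Fin N) ℝ)
    (hPnn : ∀ k z i j, 0 ≤ P k z i j) (x : Fin N → ℝ) (hx : memX N x) (k : Fin M) (z : Z)
    (h : sigz P k z x ≠ 0) : memX N (lam P k z x) := by
  refine ⟨fun j => div_nonneg (Finset.sum_nonneg fun i _ => mul_nonneg (hx.1 i) (hPnn k z i j))
    (sigz_nonneg P hPnn x hx k z), ?_⟩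
  unfold lam
  rw [← Finset.sum_div, div_eq_one_iff_eq h, Finset.sum_comm]
  unfold sigz
  simp only [Finset.mul_sum]

lemma Lf_min (P : Fin M → Z → Matrix (Fin N) (Fin N) ℝ) (hM : 1 ≤ M)
    (hPnn : ∀ k z i j, 0 ≤ P k z i j) (d : Fin M → ℤ) (p hc : ℝ) (hp : 0 < p) (hhc : 0 < hc)
    (x : Fin N → ℝ) (hx : memX N x) (y : ℤ) :
    ∃ k, Lf P d p hc x (d k : ℝ) ≤ Lf P d p hc x (y : ℝ) := by
  have hs : ∀ k, 0 ≤ sig P k x := fun k => Finset.sum_nonneg fun z _ => sigz_nonneg P hPnn x hx k z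
  haveI : Nonempty (Fin M) := ⟨⟨0, hM⟩⟩
  by_cases hA : ∃ k, d k ≤ y
  · obtain ⟨a, ha, ha'⟩ := Finset.exists_max_image (univ.filter fun k => d k ≤ y) d
      (by obtain ⟨k, hk⟩ := hA; exact ⟨k, by simpa using hk⟩)
    simp only [mem_filter, mem_univ, true_and] at ha ha'
    by_cases hB : ∃ k, y < d k
    · obtain ⟨b, hb, hb'⟩ := Finset.exists_min_image (univ.filter fun k => y < d k) d
        (by obtain ⟨k, hk⟩ := hB; exact ⟨k, by simpa using hk⟩)
      simp only [mem_filter, mem_univ, true_and] at hb hb'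
      have hay : (d a : ℝ) ≤ y := by exact_mod_cast ha
      have hyb : (y : ℝ) < d b := by exact_mod_cast hb
      have key : ((d b : ℝ) - y) * Lf P d p hc x (d a) + ((y : ℝ) - d a) * Lf P d p hc x (d b) =
          ((d b : ℝ) - d a) * Lf P d p hc x y := by
        unfold Lf
        simp only [Finset.mul_sum]
        rw [← Finset.sum_add_distrib]
        refine Finset.sum_congr rfl fun k _ => ?_
        have h := cst_affine p hc (d a) (d b) y (d k) hay hyb.le (by
          rcases le_or_gt (d k) y with h | h
          · left; exact_mod_cast ha' k h
          · right; exact_mod_cast hb' k h)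
        linear_combination sig P k x * h
      by_contra! hcon
      have h1 := hcon a
      have h2 := hcon b
      nlinarith [mul_pos (sub_pos.2 hyb) (sub_pos.2 h1),
        mul_nonneg (sub_nonneg.2 hay) (sub_pos.2 h2).le]
    · push Not at hB
      refine ⟨a, Finset.sum_le_sum fun k _ => mul_le_mul_of_nonneg_left ?_ (hs k)⟩
      have h1 : (d k : ℝ) ≤ d a := by exact_mod_cast ha' k (hB k)
      have h2 : (d a : ℝ) ≤ y := by exact_mod_cast ha
      unfold cst
      rw [max_eq_right (show (d k : ℝ) - d a ≤ 0 by linarith),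
        max_eq_right (show (d k : ℝ) - y ≤ 0 by linarith)]
      gcongr
  · push Not at hA
    obtain ⟨a, -, ha'⟩ := Finset.exists_min_image univ d univ_nonempty
    refine ⟨a, Finset.sum_le_sum fun k _ => mul_le_mul_of_nonneg_left ?_ (hs k)⟩
    have h1 : (d a : ℝ) ≤ d k := by exact_mod_cast ha' k (mem_univ k)
    have h2 : (y : ℝ) < d a := by exact_mod_cast hA a
    unfold cst
    rw [max_eq_right (show (d a : ℝ) - d k ≤ 0 by linarith),
      max_eq_right (show (y : ℝ) - d k ≤ 0 by linarith)]
    gcongr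

lemma sStar_min (P : Fin M → Z → Matrix (Fin N) (Fin N) ℝ) (hM : 1 ≤ M)
    (hPnn : ∀ k z i j, 0 ≤ P k z i j) (d : Fin M → ℤ) (p hc : ℝ) (hp : 0 < p) (hhc : 0 < hc)
    (x : Fin N → ℝ) (hx : memX N x) (y : ℤ) :
    Lf P d p hc x (sStar P d p hc x : ℝ) ≤ Lf P d p hc x (y : ℝ) := by
  haveI : Nonempty (Fin M) := ⟨⟨0, hM⟩⟩
  have hmem : sStar P d p hc x ∈ {t : ℤ | ∃ m : Fin M, t = d m ∧
      ∀ k : Fin M, Lf P d p hc x (d m : ℝ) ≤ Lf P d p hc x (d k : ℝ)} := by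
    apply Int.csInf_mem
    · obtain ⟨a, -, ha⟩ := Finset.exists_min_image univ
        (fun k : Fin M => Lf P d p hc x (d k : ℝ)) univ_nonempty
      exact ⟨d a, a, rfl, fun k => ha k (mem_univ k)⟩
    · refine ((Set.finite_range d).subset ?_).bddBelow
      rintro t ⟨m, rfl, -⟩
      exact ⟨m, rfl⟩
  obtain ⟨m, hm, hmin⟩ := hmem
  obtain ⟨k, hk⟩ := Lf_min P hM hPnn d p hc hp hhc x hx y
  rw [hm]
  exact (hmin k).trans hk

/-- The bracket minimized in the recursion. -/
def Qf (P : Fin M → Z → Matrix (Fin N) (Fin N) ℝ) (d : Fin M → ℤ) (p hc β : ℝ)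
    (f : ℤ → ℤ → ℤ) (n : ℕ) (x : Fin N → ℝ) (y : ℤ) : ℝ :=
  Lf P d p hc x (y : ℝ) + β * ∑ k, ∑ z,
    (if sigz P k z x = 0 then 0
     else sigz P k z x * vIter P d p hc β f n (lam P k z x) (f y (d k)))

lemma Lf_conv (P : Fin M → Z → Matrix (Fin N) (Fin N) ℝ)
    (hPnn : ∀ k z i j, 0 ≤ P k z i j) (d : Fin M → ℤ) (p hc : ℝ) (hp : 0 < p) (hhc : 0 < hc)
    (x : Fin N → ℝ) (hx : memX N x) (s s' : ℤ) (h : s ≤ s') :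
    Lf P d p hc x ((s + 1 : ℤ) : ℝ) - Lf P d p hc x (s : ℝ) ≤
      Lf P d p hc x ((s' + 1 : ℤ) : ℝ) - Lf P d p hc x (s' : ℝ) := by
  unfold Lf
  rw [← Finset.sum_sub_distrib, ← Finset.sum_sub_distrib]
  refine Finset.sum_le_sum fun k _ => ?_
  rw [← mul_sub, ← mul_sub]
  exact mul_le_mul_of_nonneg_left (cst_conv p hc hp hhc (d k) s s' h)
    (Finset.sum_nonneg fun z _ => sigz_nonneg P hPnn x hx k z)

/-- Proposition 1: under Assumption A1 (with `f` nondecreasing and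
convex in the inventory position), `v_n(x,s) = v_n(x, max{s*(x),s})`, `v_n(x,·)` is
nondecreasing and convex, and the myopic base stock action attains the infimum. -/
theorem stmt7 {N M : ℕ} {Z : Type*} [Fintype Z] [Nonempty Z]
    (hN : 1 ≤ N) (hM : 1 ≤ M)
    (d : Fin M → ℤ) (hd : StrictMono d)
    (P : Fin M → Z → Matrix (Fin N) (Fin N) ℝ)
    (hPnn : ∀ k z i j, 0 ≤ P k z i j)
    (hPst : ∀ i : Fin N, ∑ k : Fin M, ∑ z : Z, ∑ j : Fin N, P k z i j = 1)
    (p hc : ℝ) (hp : 0 < p) (hhc : 0 < hc)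
    (β : ℝ) (hβ0 : 0 ≤ β) (hβ1 : β < 1)
    (f : ℤ → ℤ → ℤ)
    (hfmono : ∀ k : Fin M, Monotone fun y => f y (d k))
    (hfconv : ∀ k : Fin M, ∀ y y' : ℤ, y ≤ y' →
      f (y + 1) (d k) - f y (d k) ≤ f (y' + 1) (d k) - f y' (d k))
    (hA1 : ∀ x : Fin N → ℝ, memX N x → ∀ (k : Fin M) (z : Z), sigz P k z x ≠ 0 →
      f (sStar P d p hc x) (d k) ≤ sStar P d p hc (lam P k z x)) :
    ∀ (n : ℕ) (x : Fin N → ℝ), memX N x →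
      -- (a) v_n(x,s) = v_n(x, max{s*(x),s})
      (∀ s : ℤ, vIter P d p hc β f n x s = vIter P d p hc β f n x (max (sStar P d p hc x) s)) ∧
      -- (b) s ↦ v_n(x,s) is nondecreasing and convex on ℤ
      (∀ s s' : ℤ, s ≤ s' → vIter P d p hc β f n x s ≤ vIter P d p hc β f n x s') ∧
      (∀ s s' : ℤ, s ≤ s' →
        vIter P d p hc β f n x (s + 1) - vIter P d p hc β f n x s ≤
          vIter P d p hc β f n x (s' + 1) - vIter P d p hc β f n x s') ∧
      -- (c) the myopic base stock action attains the infimum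
      (∀ s : ℤ,
        vIter P d p hc β f (n + 1) x s =
          Lf P d p hc x ((max (sStar P d p hc x) s : ℤ) : ℝ) + β * ∑ k, ∑ z,
            (if sigz P k z x = 0 then 0
             else sigz P k z x *
               vIter P d p hc β f n (lam P k z x) (f (max (sStar P d p hc x) s) (d k)))) := by
  have main : ∀ n : ℕ, (∀ x : Fin N → ℝ, memX N x →
      (∀ s : ℤ, vIter P d p hc β f n x s = vIter P d p hc β f n x (max (sStar P d p hc x) s)) ∧
      (∀ s s' : ℤ, s ≤ s' → vIter P d p hc β f n x s ≤ vIter P d p hc β f n x s') ∧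
      (∀ s s' : ℤ, s ≤ s' →
        vIter P d p hc β f n x (s + 1) - vIter P d p hc β f n x s ≤
          vIter P d p hc β f n x (s' + 1) - vIter P d p hc β f n x s')) →
      ∀ x : Fin N → ℝ, memX N x →
        (∀ s s' : ℤ, s ≤ s' → Qf P d p hc β f n x (s + 1) - Qf P d p hc β f n x s ≤
          Qf P d p hc β f n x (s' + 1) - Qf P d p hc β f n x s') ∧
        (∀ y, Qf P d p hc β f n x (sStar P d p hc x) ≤ Qf P d p hc β f n x y) := by
    intro n ih x hx
    refine ⟨fun s s' h => ?_, fun y => ?_⟩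
    · have h1 := Lf_conv P hPnn d p hc hp hhc x hx s s' h
      have h2 : (∑ k, ∑ z, (if sigz P k z x = 0 then 0
            else sigz P k z x * vIter P d p hc β f n (lam P k z x) (f (s + 1) (d k))))
          - (∑ k, ∑ z, (if sigz P k z x = 0 then 0
            else sigz P k z x * vIter P d p hc β f n (lam P k z x) (f s (d k))))
          ≤ (∑ k, ∑ z, (if sigz P k z x = 0 then 0
            else sigz P k z x * vIter P d p hc β f n (lam P k z x) (f (s' + 1) (d k))))
          - (∑ k, ∑ z, (if sigz P k z x = 0 then 0
            else sigz P k z x * vIter P d p hc β f n (lam P k z x) (f s' (d k)))) := by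
        simp only [← Finset.sum_sub_distrib]
        refine Finset.sum_le_sum fun k _ => Finset.sum_le_sum fun z _ => ?_
        split_ifs with h0
        · simp
        · rw [← mul_sub, ← mul_sub]
          obtain ⟨-, hm, hcv⟩ := ih _ (lam_mem P hPnn x hx k z h0)
          exact mul_le_mul_of_nonneg_left
            (aux_comp _ hm hcv _ _ _ _ (hfmono k (by omega)) (hfmono k h) (hfconv k s s' h))
            (sigz_nonneg P hPnn x hx k z)
      have h3 := mul_le_mul_of_nonneg_left h2 hβ0
      unfold Qf
      linarith
    · unfold Qf
      refine add_le_add (sStar_min P hM hPnn d p hc hp hhc x hx y)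
        (mul_le_mul_of_nonneg_left ?_ hβ0)
      refine Finset.sum_le_sum fun k _ => Finset.sum_le_sum fun z _ => ?_
      split_ifs with h0
      · exact le_rfl
      · refine mul_le_mul_of_nonneg_left ?_ (sigz_nonneg P hPnn x hx k z)
        obtain ⟨ha, hm, -⟩ := ih _ (lam_mem P hPnn x hx k z h0)
        rw [ha (f (sStar P d p hc x) (d k)), ha (f y (d k)), max_eq_left (hA1 x hx k z h0)]
        exact hm _ _ (le_max_left _ _)
  have hval : ∀ (n : ℕ) (x : Fin N → ℝ),
        (∀ s s' : ℤ, s ≤ s' → Qf P d p hc β f n x (s + 1) - Qf P d p hc β f n x s ≤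
          Qf P d p hc β f n x (s' + 1) - Qf P d p hc β f n x s') →
        (∀ y, Qf P d p hc β f n x (sStar P d p hc x) ≤ Qf P d p hc β f n x y) →
        ∀ s, vIter P d p hc β f (n + 1) x s = Qf P d p hc β f n x (max (sStar P d p hc x) s) := by
    intro n x h1 h2 s
    rw [← aux_inf _ _ h1 h2 s]
    rfl
  have hab : ∀ n : ℕ, ∀ x : Fin N → ℝ, memX N x →
      (∀ s : ℤ, vIter P d p hc β f n x s = vIter P d p hc β f n x (max (sStar P d p hc x) s)) ∧
      (∀ s s' : ℤ, s ≤ s' → vIter P d p hc β f n x s ≤ vIter P d p hc β f n x s') ∧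
      (∀ s s' : ℤ, s ≤ s' →
        vIter P d p hc β f n x (s + 1) - vIter P d p hc β f n x s ≤
          vIter P d p hc β f n x (s' + 1) - vIter P d p hc β f n x s') := by
    intro n
    induction n with
    | zero => intro x _; simp [vIter]
    | succ n ih =>
      intro x hx
      obtain ⟨h1, h2⟩ := main n ih x hx
      have hv := hval n x h1 h2
      refine ⟨fun s => ?_, fun s s' h => ?_, fun s s' h => ?_⟩
      · rw [hv, hv, max_eq_right (le_max_left _ (s : ℤ))]
      · rw [hv, hv]
        exact aux_mono _ _ h1 h2 _ _ (le_max_left _ _) (max_le_max le_rfl h)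
      · rw [hv, hv, hv, hv]
        exact aux_conv_max _ _ h1 h2 s s' h
  intro n x hx
  obtain ⟨ha, hb, hb'⟩ := hab n x hx
  obtain ⟨h1, h2⟩ := main n (hab n) x hx
  exact ⟨ha, hb, hb', hval n x h1 h2⟩

end InvCtrl
end
end
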